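/- Let C be a finite nonempty type, let p̃ and μ be probability vectors on C, let V : C → ℝ, let η > 0 and α ≥ 0. Define the posterior a c := (exp (V c / η) * p̃ c) / (∑_{c'} exp (V c' / η) * p̃ c'), and define w c := p̃ c * exp ((V c + η * α * (log (μ c) − log (p̃ c))) / (η + η * α)) with normalization q* c := w c / (∑_{c'} w c'). Then q* is the unique minimizer of q ↦ KL(q‖a) + α * KL(q‖μ) over all probability vectors q on C. -/

import Mathlib

/-- The summand of the Kullback–Leibler divergence dominates its first-order term. -/
lemma sub_le_mul_log_div {x y : ℝ} (hx : 0 < x) (hy : 0 < y) :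
    x - y ≤ x * Real.log (x / y) := by
  have h := mul_le_mul_of_nonneg_left (Real.one_sub_inv_le_log_of_pos (div_pos hx hy)) hx.le
  have e : x * (1 - (x / y)⁻¹) = x - y := by field_simp
  rwa [e] at h

lemma sub_lt_mul_log_div {x y : ℝ} (hx : 0 < x) (hy : 0 < y) (hxy : x ≠ y) :
    x - y < x * Real.log (x / y) := by
  have hne : y / x ≠ 1 := fun h => hxy ((div_eq_one_iff_eq hx.ne').1 h).symm
  have h := mul_lt_mul_of_pos_left (Real.log_lt_sub_one_of_pos (div_pos hy hx) hne) hx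
  have e : x * (y / x - 1) = y - x := by field_simp
  rw [e, ← inv_div x y, Real.log_inv] at h
  linarith

/-- Gibbs' inequality for finite sums. -/
lemma sum_mul_log_div_nonneg {C : Type*} [Fintype C] {p q : C → ℝ}
    (hp : ∀ c, 0 < p c) (hq : ∀ c, 0 < q c) (h : ∑ c, q c = ∑ c, p c) :
    0 ≤ ∑ c, q c * Real.log (q c / p c) := by
  calc 0 = ∑ c, (q c - p c) := by rw [Finset.sum_sub_distrib, h, sub_self]
    _ ≤ _ := Finset.sum_le_sum fun c _ => sub_le_mul_log_div (hq c) (hp c)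

/-- The equality case of Gibbs' inequality. -/
lemma eq_of_sum_mul_log_div_eq_zero {C : Type*} [Fintype C] {p q : C → ℝ}
    (hp : ∀ c, 0 < p c) (hq : ∀ c, 0 < q c) (h : ∑ c, q c = ∑ c, p c)
    (h0 : ∑ c, q c * Real.log (q c / p c) = 0) : q = p := by
  by_contra hne
  obtain ⟨c, hc⟩ := Function.ne_iff.1 hne
  have hlt : ∑ c, (q c - p c) < ∑ c, q c * Real.log (q c / p c) :=
    Finset.sum_lt_sum (fun c _ => sub_le_mul_log_div (hq c) (hp c))
      ⟨c, Finset.mem_univ c, sub_lt_mul_log_div (hq c) (hp c) hc⟩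
  rw [Finset.sum_sub_distrib, h, sub_self, h0] at hlt
  exact hlt.false

/-- If `r` is, up to a constant `K`, the geometric mixture of `a` and `m` with weights `1 : α`, then
`KL(q‖a) + α KL(q‖m)` is an affine function of `KL(q‖r)`. -/
lemma sum_mul_log_div_add_mul_sum {C : Type*} [Fintype C] {a m r q : C → ℝ} {α K : ℝ}
    (ha : ∀ c, 0 < a c) (hm : ∀ c, 0 < m c) (hr : ∀ c, 0 < r c) (hq : ∀ c, 0 < q c)
    (hq1 : ∑ c, q c = 1)
    (h : ∀ c, Real.log (a c) + α * Real.log (m c) = (1 + α) * Real.log (r c) + K) :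
    (∑ c, q c * Real.log (q c / a c)) + α * (∑ c, q c * Real.log (q c / m c))
      = (1 + α) * (∑ c, q c * Real.log (q c / r c)) - K := by
  have hK : K = ∑ c, q c * K := by rw [← Finset.sum_mul, hq1, one_mul]
  rw [hK, Finset.mul_sum, Finset.mul_sum, ← Finset.sum_add_distrib, ← Finset.sum_sub_distrib]
  refine Finset.sum_congr rfl fun c _ => ?_
  rw [Real.log_div (hq c).ne' (ha c).ne', Real.log_div (hq c).ne' (hm c).ne',
    Real.log_div (hq c).ne' (hr c).ne']
  linear_combination (-q c) * h c

/-- Finite-context form of Theorem 2: with likelihood proportional to `exp(V c / η)`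
and resulting posterior `a`, the unique minimizer of `q ↦ KL(q‖a) + α KL(q‖mu)` over
probability vectors is `q* c ∝ pt c * exp((V c + ηα(log mu c − log pt c)) / (η + ηα))`. -/
theorem sprl_variational_distribution {C : Type*} [Fintype C] [Nonempty C]
    (pt mu : C → ℝ)
    (hpt : ∀ c, 0 < pt c) (hpt1 : ∑ c, pt c = 1)
    (hmu : ∀ c, 0 < mu c) (hmu1 : ∑ c, mu c = 1)
    (V : C → ℝ) (η α : ℝ) (hη : 0 < η) (hα : 0 ≤ α)
    (a : C → ℝ)
    (ha : ∀ c, a c = (Real.exp (V c / η) * pt c) / (∑ c', Real.exp (V c' / η) * pt c'))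
    (w : C → ℝ)
    (hw : ∀ c, w c = pt c *
      Real.exp ((V c + η * α * (Real.log (mu c) - Real.log (pt c))) / (η + η * α)))
    (qstar : C → ℝ) (hqstar : ∀ c, qstar c = w c / (∑ c', w c')) :
    ((∀ c, 0 < qstar c) ∧ (∑ c, qstar c = 1))
    ∧ (∀ q : C → ℝ, (∀ c, 0 < q c) → (∑ c, q c = 1) →
        (∑ c, qstar c * Real.log (qstar c / a c))
            + α * (∑ c, qstar c * Real.log (qstar c / mu c))
          ≤ (∑ c, q c * Real.log (q c / a c)) + α * (∑ c, q c * Real.log (q c / mu c)))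
    ∧ (∀ q : C → ℝ, (∀ c, 0 < q c) → (∑ c, q c = 1) →
        (∑ c, q c * Real.log (q c / a c)) + α * (∑ c, q c * Real.log (q c / mu c))
          = (∑ c, qstar c * Real.log (qstar c / a c))
            + α * (∑ c, qstar c * Real.log (qstar c / mu c))
        → q = qstar) := by
  have hZ : 0 < ∑ c', Real.exp (V c' / η) * pt c' :=
    Finset.sum_pos (fun c _ => mul_pos (Real.exp_pos _) (hpt c)) Finset.univ_nonempty
  have hwpos : ∀ c, 0 < w c := fun c => hw c ▸ mul_pos (hpt c) (Real.exp_pos _)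
  have hW : 0 < ∑ c', w c' := Finset.sum_pos (fun c _ => hwpos c) Finset.univ_nonempty
  have hapos : ∀ c, 0 < a c := fun c =>
    ha c ▸ div_pos (mul_pos (Real.exp_pos _) (hpt c)) hZ
  have hspos : ∀ c, 0 < qstar c := fun c => hqstar c ▸ div_pos (hwpos c) hW
  have hs1 : ∑ c, qstar c = 1 := by
    simp_rw [hqstar]
    rw [← Finset.sum_div, div_self hW.ne']
  have key : ∀ c, Real.log (a c) + α * Real.log (mu c) = (1 + α) * Real.log (qstar c) +
      ((1 + α) * Real.log (∑ c', w c') -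
        Real.log (∑ c', Real.exp (V c' / η) * pt c')) := by
    intro c
    rw [hqstar c, Real.log_div (hwpos c).ne' hW.ne', hw c,
      Real.log_mul (hpt c).ne' (Real.exp_pos _).ne', Real.log_exp, ha c,
      Real.log_div (mul_pos (Real.exp_pos _) (hpt c)).ne' hZ.ne',
      Real.log_mul (Real.exp_pos _).ne' (hpt c).ne', Real.log_exp]
    have e : (1 + α) * ((V c + η * α * (Real.log (mu c) - Real.log (pt c))) / (η + η * α))
        = V c / η + α * (Real.log (mu c) - Real.log (pt c)) := by
      have h1 : 1 + α ≠ 0 := by positivity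
      rw [show η + η * α = η * (1 + α) by ring]
      field_simp
    linear_combination -e
  have obj := fun (q : C → ℝ) (hq : ∀ c, 0 < q c) (hq1 : ∑ c, q c = 1) =>
    sum_mul_log_div_add_mul_sum hapos hmu hspos hq hq1 key
  have hself : ∑ c, qstar c * Real.log (qstar c / qstar c) = 0 :=
    Finset.sum_eq_zero fun c _ => by rw [div_self (hspos c).ne', Real.log_one, mul_zero]
  refine ⟨⟨hspos, hs1⟩, fun q hq hq1 => ?_, fun q hq hq1 heq => ?_⟩
  · rw [obj q hq hq1, obj qstar hspos hs1, hself, mul_zero]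
    have := mul_nonneg (by positivity : 0 ≤ 1 + α)
      (sum_mul_log_div_nonneg hspos hq (hq1.trans hs1.symm))
    linarith
  · rw [obj q hq hq1, obj qstar hspos hs1, hself, mul_zero, sub_left_inj] at heq
    exact eq_of_sum_mul_log_div_eq_zero hspos hq (hq1.trans hs1.symm)
      ((mul_eq_zero.1 heq).resolve_left (by positivity))
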